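/- arXiv:2004.10785 — 2 statements merged into one kernel-verified Lean document; each statement's English description precedes it below -/
import Mathlib

section
/- Let η be the 3×3 real diagonal matrix with diagonal entries (−1,1,1), let 𝔨 = {a ∈ M₃(ℝ) : a η + η aᵀ = 0}, let ⟨a,b⟩ := tr(η⁻¹ aᵀ η b), and for ξ ∈ ℝ³ let ξ̃ ∈ 𝔨 be the matrix with entries ξ̃^j_i = Σ_{k,l}(η⁻¹)^{jk} ε_{ikl} ξ^l. Then the bilinear form on 𝔨 ⊕ ℝ³ defined by ⟨(a,ξ),(b,ζ)⟩ := ⟨a, ζ̃⟩ + ⟨b, ξ̃⟩ is symmetric and nondegenerate: if ⟨(a,ξ),(b,ζ)⟩ = 0 for all (b,ζ) ∈ 𝔨 ⊕ ℝ³, then a = 0 and ξ = 0. -/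
open Matrix

/-- The Levi-Civita symbol on three indices: totally antisymmetric with `ε 0 1 2 = 1`
(i.e. `ε_{123} = 1` in one-based notation). -/
noncomputable def leviCivita3 (i k l : Fin 3) : ℝ :=
  (((k : ℕ) : ℝ) - ((i : ℕ) : ℝ)) * (((l : ℕ) : ℝ) - ((i : ℕ) : ℝ)) *
    (((l : ℕ) : ℝ) - ((k : ℕ) : ℝ)) / 2

/-- The linear isomorphism `ℝ³ ≅ 𝔨`, `ξ ↦ ξ̃`, with entries
`ξ̃ʲᵢ = Σ_{k,l} (η⁻¹)^{jk} ε_{ikl} ξ^l`. -/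
noncomputable def tildeMap (η : Matrix (Fin 3) (Fin 3) ℝ) (ξ : Fin 3 → ℝ) :
    Matrix (Fin 3) (Fin 3) ℝ :=
  fun j i => ∑ k, ∑ l, η⁻¹ j k * leviCivita3 i k l * ξ l

/-- The invariant bilinear form `⟨a,b⟩ = tr (η⁻¹ aᵀ η b)` on `M₃(ℝ)`. -/
noncomputable def ipForm (η a b : Matrix (Fin 3) (Fin 3) ℝ) : ℝ :=
  (η⁻¹ * aᵀ * η * b).trace

/-- The Minkowski metric with signature `(-1, 1, 1)` is its own inverse. -/
theorem minkowski_inv :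
    (!![-1, 0, 0; 0, 1, 0; 0, 0, 1] : Matrix (Fin 3) (Fin 3) ℝ)⁻¹ =
      !![-1, 0, 0; 0, 1, 0; 0, 0, 1] := by
  apply Matrix.inv_eq_left_inv
  ext i j
  fin_cases i <;> fin_cases j <;> simp [Matrix.mul_apply, Fin.sum_univ_three]

/-- The matrix `ξ̃` for the Minkowski metric. -/
theorem tildeMap_minkowski (ξ : Fin 3 → ℝ) :
    tildeMap !![-1, 0, 0; 0, 1, 0; 0, 0, 1] ξ =
      !![0, ξ 2, -ξ 1; ξ 2, 0, -ξ 0; -ξ 1, ξ 0, 0] := by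
  ext i j
  fin_cases i <;> fin_cases j <;>
    simp [tildeMap, minkowski_inv, leviCivita3, Fin.sum_univ_three] <;> ring

/-- The pairing `⟨a, ξ̃⟩` for the Minkowski metric, in coordinates. -/
theorem ipForm_tildeMap_minkowski (a : Matrix (Fin 3) (Fin 3) ℝ) (ξ : Fin 3 → ℝ) :
    ipForm !![-1, 0, 0; 0, 1, 0; 0, 0, 1] a (tildeMap !![-1, 0, 0; 0, 1, 0; 0, 0, 1] ξ) =
      (a 2 1 - a 1 2) * ξ 0 + (a 0 2 + a 2 0) * ξ 1 - (a 0 1 + a 1 0) * ξ 2 := by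
  rw [ipForm, minkowski_inv, tildeMap_minkowski]
  simp only [Matrix.trace, Matrix.diag_apply, Matrix.mul_apply, Fin.sum_univ_three]
  simp
  ring

/-- `ξ̃` lies in the Lie algebra of the Lorentz group. -/
theorem tildeMap_minkowski_mem (ξ : Fin 3 → ℝ) :
    tildeMap !![-1, 0, 0; 0, 1, 0; 0, 0, 1] ξ * !![-1, 0, 0; 0, 1, 0; 0, 0, 1] +
      !![-1, 0, 0; 0, 1, 0; 0, 0, 1] * (tildeMap !![-1, 0, 0; 0, 1, 0; 0, 0, 1] ξ)ᵀ = 0 := by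
  rw [tildeMap_minkowski]
  ext i j
  simp only [Matrix.add_apply, Matrix.mul_apply, Fin.sum_univ_three, Matrix.transpose_apply]
  fin_cases i <;> fin_cases j <;> simp

/-- the bilinear form on `𝔨 ⊕ ℝ³ = 𝔦𝔰𝔬(2,1)` given by
`⟨(a,ξ),(b,ζ)⟩ := ⟨a, ζ̃⟩ + ⟨b, ξ̃⟩` is symmetric and nondegenerate. -/
theorem stmt11 (η : Matrix (Fin 3) (Fin 3) ℝ)
    (hη : η = Matrix.diagonal (fun i : Fin 3 => if (i : ℕ) = 0 then (-1 : ℝ) else 1)) :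
    (∀ (a b : Matrix (Fin 3) (Fin 3) ℝ) (ξ ζ : Fin 3 → ℝ),
        a * η + η * aᵀ = 0 → b * η + η * bᵀ = 0 →
        ipForm η a (tildeMap η ζ) + ipForm η b (tildeMap η ξ) =
          ipForm η b (tildeMap η ξ) + ipForm η a (tildeMap η ζ)) ∧
    (∀ (a : Matrix (Fin 3) (Fin 3) ℝ) (ξ : Fin 3 → ℝ),
        a * η + η * aᵀ = 0 →
        (∀ (b : Matrix (Fin 3) (Fin 3) ℝ) (ζ : Fin 3 → ℝ),
            b * η + η * bᵀ = 0 →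
            ipForm η a (tildeMap η ζ) + ipForm η b (tildeMap η ξ) = 0) →
        a = 0 ∧ ξ = 0) := by
  have hη' : η = !![-1, 0, 0; 0, 1, 0; 0, 0, 1] := by
    rw [hη]
    ext i j
    fin_cases i <;> fin_cases j <;> simp
  clear hη
  subst hη'
  refine ⟨fun a b ξ ζ _ _ => add_comm _ _, fun a ξ ha h => ?_⟩
  simp only [ipForm_tildeMap_minkowski] at h
  constructor
  · have e (i j : Fin 3) := congrFun (congrFun ha i) j
    simp only [Matrix.add_apply, Matrix.mul_apply, Fin.sum_univ_three, Matrix.transpose_apply,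
      Matrix.zero_apply] at e
    have h0 := h 0 ![1, 0, 0] (by simp)
    have h1 := h 0 ![0, 1, 0] (by simp)
    have h2 := h 0 ![0, 0, 1] (by simp)
    have e00 := e 0 0
    have e11 := e 1 1
    have e22 := e 2 2
    have e01 := e 0 1
    have e02 := e 0 2
    have e12 := e 1 2
    simp at h0 h1 h2 e00 e11 e22 e01 e02 e12
    ext i j
    fin_cases i <;> fin_cases j <;> simp <;> linarith
  · have h0 := h _ 0 (tildeMap_minkowski_mem ![1, 0, 0])
    have h1 := h _ 0 (tildeMap_minkowski_mem ![0, 1, 0])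
    have h2 := h _ 0 (tildeMap_minkowski_mem ![0, 0, 1])
    simp [tildeMap_minkowski] at h0 h1 h2
    ext i
    fin_cases i <;> simp <;> linarith
end

section
/- Let η be the 3×3 real diagonal matrix with diagonal entries (−1,1,1), let 𝔨 = {a ∈ M₃(ℝ) : a η + η aᵀ = 0}, 𝔭 = {a ∈ M₃(ℝ) : a η − η aᵀ = 0}, ⟨a,b⟩ := tr(η⁻¹ aᵀ η b), and for ξ ∈ ℝ³ let ξ̃ ∈ 𝔨 be the matrix with entries ξ̃^j_i = Σ_{k,l}(η⁻¹)^{jk} ε_{ikl} ξ^l. Write each a ∈ M₃(ℝ) uniquely as a = a_𝔨 + a_𝔭 with a_𝔨 ∈ 𝔨, a_𝔭 ∈ 𝔭. Then the bilinear form on 𝔤𝔩(3,ℝ) ⊕ ℝ³ defined by Q((a,ξ),(b,ζ)) := ⟨a_𝔭, b_𝔭⟩ + ⟨a_𝔨, ζ̃⟩ + ⟨b_𝔨, ξ̃⟩ is symmetric and nondegenerate; it restricts to ⟨·,·⟩ on 𝔭 ⊕ 0, it makes 𝔭 ⊕ 0 orthogonal to 𝔨 ⊕ ℝ³, and on 𝔨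 ⊕ ℝ³ it agrees with the pairing ⟨a, ζ̃⟩ + ⟨b, ξ̃⟩. -/
open Matrix

/-- The `𝔨`-component of `a` in the decomposition `𝔤𝔩(3,ℝ) = 𝔨 ⊕ 𝔭`. -/
noncomputable def projK (η a : Matrix (Fin 3) (Fin 3) ℝ) : Matrix (Fin 3) (Fin 3) ℝ :=
  (1 / 2 : ℝ) • (a - η * aᵀ * η)

/-- The `𝔭`-component of `a` in the decomposition `𝔤𝔩(3,ℝ) = 𝔨 ⊕ 𝔭`. -/
noncomputable def projP (η a : Matrix (Fin 3) (Fin 3) ℝ) : Matrix (Fin 3) (Fin 3) ℝ :=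
  (1 / 2 : ℝ) • (a + η * aᵀ * η)

/-- The bilinear form `Q` on `𝔞(3,ℝ) ≅ 𝔤𝔩(3,ℝ) ⊕ ℝ³`:
`Q((a,ξ),(b,ζ)) = ⟨a_𝔭, b_𝔭⟩ + ⟨a_𝔨, ζ̃⟩ + ⟨b_𝔨, ξ̃⟩`. -/
noncomputable def affQ (η : Matrix (Fin 3) (Fin 3) ℝ)
    (p q : Matrix (Fin 3) (Fin 3) ℝ × (Fin 3 → ℝ)) : ℝ :=
  ipForm η (projP η p.1) (projP η q.1) + ipForm η (projK η p.1) (tildeMap η q.2) +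
    ipForm η (projK η q.1) (tildeMap η p.2)

section AffineForm

variable {η a b : Matrix (Fin 3) (Fin 3) ℝ}

theorem projK_add_projP (η a : Matrix (Fin 3) (Fin 3) ℝ) : projK η a + projP η a = a := by
  rw [projK, projP, ← smul_add, sub_add_add_cancel, ← two_smul ℝ a, smul_smul]
  norm_num

theorem projK_mul_add (h : η * η = 1) (ht : ηᵀ = η) :
    projK η a * η + η * (projK η a)ᵀ = 0 := by
  simp only [projK, transpose_smul, transpose_sub, transpose_mul, transpose_transpose, ht,
    smul_mul_assoc, mul_smul_comm, ← smul_add, sub_mul, mul_sub, mul_assoc, h, mul_one]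
  simp [← mul_assoc, h]

theorem projP_mul_sub (h : η * η = 1) (ht : ηᵀ = η) :
    projP η a * η - η * (projP η a)ᵀ = 0 := by
  simp only [projP, transpose_smul, transpose_add, transpose_mul, transpose_transpose, ht,
    smul_mul_assoc, mul_smul_comm, ← smul_sub, add_mul, mul_add, mul_assoc, h, mul_one]
  simp [← mul_assoc, h, add_comm]

theorem mul_transpose_mul_of_mem_p (h : η * η = 1) (ha : a * η - η * aᵀ = 0) :
    η * aᵀ * η = a := by
  rw [← sub_eq_zero.mp ha, mul_assoc, h, mul_one]

theorem mul_transpose_mul_of_mem_k (h : η * η = 1) (ha : a * η + η * aᵀ = 0) :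
    η * aᵀ * η = -a := by
  rw [← neg_eq_of_add_eq_zero_right ha, neg_mul, mul_assoc, h, mul_one]

theorem projK_of_mem_p (h : η * η = 1) (ha : a * η - η * aᵀ = 0) : projK η a = 0 := by
  rw [projK, mul_transpose_mul_of_mem_p h ha, sub_self, smul_zero]

theorem projP_of_mem_p (h : η * η = 1) (ha : a * η - η * aᵀ = 0) : projP η a = a := by
  simpa [projK_of_mem_p h ha] using projK_add_projP η a

theorem projP_of_mem_k (h : η * η = 1) (ha : a * η + η * aᵀ = 0) : projP η a = 0 := by
  rw [projP, mul_transpose_mul_of_mem_k h ha, add_neg_cancel, smul_zero]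

theorem projK_of_mem_k (h : η * η = 1) (ha : a * η + η * aᵀ = 0) : projK η a = a := by
  simpa [projP_of_mem_k h ha] using projK_add_projP η a

theorem ipForm_zero_left (η b : Matrix (Fin 3) (Fin 3) ℝ) : ipForm η 0 b = 0 := by
  simp [ipForm]

theorem ipForm_zero_right (η a : Matrix (Fin 3) (Fin 3) ℝ) : ipForm η a 0 = 0 := by
  simp [ipForm]

theorem ipForm_comm (ht : ηᵀ = η) (a b : Matrix (Fin 3) (Fin 3) ℝ) :
    ipForm η a b = ipForm η b a := by
  rw [ipForm, ← trace_transpose, ipForm]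
  simp only [transpose_mul, transpose_transpose, transpose_nonsing_inv, ht]
  rw [← mul_assoc, ← mul_assoc, trace_mul_comm]
  simp only [mul_assoc]

theorem tildeMap_zero (η : Matrix (Fin 3) (Fin 3) ℝ) : tildeMap η 0 = 0 := by
  ext
  simp [tildeMap]

theorem affQ_comm (ht : ηᵀ = η) (p q : Matrix (Fin 3) (Fin 3) ℝ × (Fin 3 → ℝ)) :
    affQ η p q = affQ η q p := by
  rw [affQ, affQ, ipForm_comm ht (projP η p.1)]
  ring

/-- The Minkowski form in coordinates. -/
abbrev minkowski3 : Matrix (Fin 3) (Fin 3) ℝ := diagonal ![-1, 1, 1]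

theorem minkowski3_mul_self : minkowski3 * minkowski3 = 1 := by
  rw [diagonal_mul_diagonal, ← diagonal_one]
  congr 1
  ext i
  fin_cases i <;> simp

theorem minkowski3_transpose : minkowski3ᵀ = minkowski3 :=
  diagonal_transpose _

theorem minkowski3_inv : minkowski3⁻¹ = minkowski3 :=
  inv_eq_left_inv minkowski3_mul_self

theorem tildeMap_minkowski3 (ξ : Fin 3 → ℝ) :
    tildeMap minkowski3 ξ = !![0, ξ 2, -ξ 1; ξ 2, 0, -ξ 0; -ξ 1, ξ 0, 0] := by
  ext i j
  rw [tildeMap, minkowski3_inv]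
  fin_cases i <;> fin_cases j <;>
    simp [leviCivita3, Fin.sum_univ_three] <;> ring

theorem ipForm_minkowski3 (a b : Matrix (Fin 3) (Fin 3) ℝ) :
    ipForm minkowski3 a b = ∑ i, ∑ j, ![-1, 1, 1] i * a j i * ![-1, 1, 1] j * b j i := by
  rw [ipForm, minkowski3_inv, trace]
  simp only [diag_apply, Matrix.mul_apply (N := b), mul_diagonal, diagonal_mul, transpose_apply]

theorem affQ_minkowski3 (a b : Matrix (Fin 3) (Fin 3) ℝ) (ξ ζ : Fin 3 → ℝ) :
    affQ minkowski3 (a, ξ) (b, ζ) =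
      a 0 0 * b 0 0 + a 1 1 * b 1 1 + a 2 2 * b 2 2
        - (a 0 1 - a 1 0) * (b 0 1 - b 1 0) / 2 - (a 0 2 - a 2 0) * (b 0 2 - b 2 0) / 2
        + (a 1 2 + a 2 1) * (b 1 2 + b 2 1) / 2
        - (a 0 1 + a 1 0) * ζ 2 + (a 0 2 + a 2 0) * ζ 1 - (a 1 2 - a 2 1) * ζ 0
        - (b 0 1 + b 1 0) * ξ 2 + (b 0 2 + b 2 0) * ξ 1 - (b 1 2 - b 2 1) * ξ 0 := by
  simp only [affQ, ipForm_minkowski3, projK, projP, tildeMap_minkowski3, Matrix.smul_apply,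
    Matrix.add_apply, Matrix.sub_apply, mul_diagonal, diagonal_mul, transpose_apply,
    Fin.sum_univ_three]
  simp
  ring

theorem affQ_minkowski3_nondegenerate (p : Matrix (Fin 3) (Fin 3) ℝ × (Fin 3 → ℝ))
    (h : ∀ q, affQ minkowski3 p q = 0) : p = 0 := by
  obtain ⟨a, ξ⟩ := p
  have hm (i j : Fin 3) := h (Matrix.single i j 1, 0)
  have hv (l : Fin 3) := h (0, Pi.single l 1)
  simp only [affQ_minkowski3] at hm hv
  have h00 := hm 0 0
  have h01 := hm 0 1
  have h02 := hm 0 2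
  have h10 := hm 1 0
  have h11 := hm 1 1
  have h12 := hm 1 2
  have h20 := hm 2 0
  have h21 := hm 2 1
  have h22 := hm 2 2
  have v0 := hv 0
  have v1 := hv 1
  have v2 := hv 2
  simp at h00 h01 h02 h10 h11 h12 h20 h21 h22 v0 v1 v2
  refine Prod.ext ?_ ?_
  · ext i j
    fin_cases i <;> fin_cases j <;> simp <;> linarith
  · ext l
    fin_cases l <;> simp <;> linarith

end AffineForm

/-- `Q` is a symmetric nondegenerate bilinear form on
`𝔤𝔩(3,ℝ) ⊕ ℝ³ ≅ 𝔞(3,ℝ)` (where `a = a_𝔨 + a_𝔭` is the decomposition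
`𝔤𝔩(3,ℝ) = 𝔨 ⊕ 𝔭`); it restricts to `⟨·,·⟩` on `𝔭 ⊕ 0`, makes `𝔭 ⊕ 0` orthogonal to
`𝔨 ⊕ ℝ³`, and on `𝔨 ⊕ ℝ³` agrees with the pairing `⟨a, ζ̃⟩ + ⟨b, ξ̃⟩`. -/
theorem stmt12 (η : Matrix (Fin 3) (Fin 3) ℝ)
    (hη : η = Matrix.diagonal (fun i : Fin 3 => if (i : ℕ) = 0 then (-1 : ℝ) else 1)) :
    (∀ a : Matrix (Fin 3) (Fin 3) ℝ,
        projK η a * η + η * (projK η a)ᵀ = 0 ∧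
        projP η a * η - η * (projP η a)ᵀ = 0 ∧
        projK η a + projP η a = a) ∧
    (∀ p q : Matrix (Fin 3) (Fin 3) ℝ × (Fin 3 → ℝ), affQ η p q = affQ η q p) ∧
    (∀ p : Matrix (Fin 3) (Fin 3) ℝ × (Fin 3 → ℝ),
        (∀ q : Matrix (Fin 3) (Fin 3) ℝ × (Fin 3 → ℝ), affQ η p q = 0) →
        p = 0) ∧
    (∀ a b : Matrix (Fin 3) (Fin 3) ℝ,
        a * η - η * aᵀ = 0 → b * η - η * bᵀ = 0 →
        affQ η (a, 0) (b, 0) = ipForm η a b) ∧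
    (∀ (a b : Matrix (Fin 3) (Fin 3) ℝ) (ζ : Fin 3 → ℝ),
        a * η - η * aᵀ = 0 → b * η + η * bᵀ = 0 →
        affQ η (a, 0) (b, ζ) = 0) ∧
    (∀ (a b : Matrix (Fin 3) (Fin 3) ℝ) (ξ ζ : Fin 3 → ℝ),
        a * η + η * aᵀ = 0 → b * η + η * bᵀ = 0 →
        affQ η (a, ξ) (b, ζ) =
          ipForm η a (tildeMap η ζ) + ipForm η b (tildeMap η ξ)) := by
  obtain rfl : η = minkowski3 := by
    rw [hη]
    ext i j
    fin_cases i <;> fin_cases j <;> simp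
  have h := minkowski3_mul_self
  have ht := minkowski3_transpose
  refine ⟨fun a => ⟨projK_mul_add h ht, projP_mul_sub h ht, projK_add_projP _ a⟩, affQ_comm ht,
    affQ_minkowski3_nondegenerate, fun a b ha hb => ?_, fun a b ζ ha hb => ?_,
    fun a b ξ ζ ha hb => ?_⟩
  · simp only [affQ, projP_of_mem_p h ha, projP_of_mem_p h hb, tildeMap_zero, ipForm_zero_right,
      add_zero]
  · simp only [affQ, projP_of_mem_k h hb, projK_of_mem_p h ha, tildeMap_zero, ipForm_zero_right,
      ipForm_zero_left, add_zero]
  · simp only [affQ, projP_of_mem_k h ha, projK_of_mem_k h ha, projK_of_mem_k h hb,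
      ipForm_zero_left, zero_add]
end
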